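/- Let M = E[W_B] be the expected weight matrix of the three-community stochastic block model. Then its third largest eigenvalue satisfies λ_3(M) ≥ (p − q) s. -/

import Mathlib

open Matrix

/-- The `k`-th largest eigenvalue (1-indexed, counted with multiplicity) of a
real symmetric matrix; junk value `0` if the matrix is not symmetric. -/
noncomputable def kthLargestEig {n : ℕ} (A : Matrix (Fin n) (Fin n) ℝ) (k : ℕ) : ℝ :=
  if hA : A.IsHermitian then
    ((List.ofFn hA.eigenvalues).mergeSort (fun a b => decide (b ≤ a))).getD (k - 1) 0
  else 0

/-- Community assignment for the three-community model on {0, …, 2l+s-1}: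
α = {0,…,l-1}, β = {l,…,2l-1}, γ = {2l,…,2l+s-1}. -/
def commB (l : ℕ) {n : ℕ} (i : Fin n) : ℕ :=
  if (i : ℕ) < l then 0 else if (i : ℕ) < 2 * l then 1 else 2

/-- Expected weight matrix `E[W_B]` of the three-community stochastic block model. -/
noncomputable def thetaB (p q : ℝ) (l : ℕ) (n : ℕ) : Matrix (Fin n) (Fin n) ℝ :=
  Matrix.of fun i j => if commB l i = commB l j then p else q

theorem List.le_getD_mergeSort_of_le_countP (L : List ℝ) {c : ℝ} {k : ℕ} (hk : 0 < k)
    (h : k ≤ L.countP (fun x => decide (c ≤ x))) :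
    c ≤ (L.mergeSort (fun a b => decide (b ≤ a))).getD (k - 1) 0 := by
  set S := L.mergeSort (fun a b => decide (b ≤ a)) with hS
  have hperm : S.Perm L := List.mergeSort_perm L _
  have hsorted : S.Pairwise (fun a b => b ≤ a) := by
    have := List.pairwise_mergeSort (le := fun a b : ℝ => decide (b ≤ a))
      (fun a b c hab hbc => by simp only [decide_eq_true_eq] at *; exact hbc.trans hab)
      (fun a b => by simpa using le_total b a) L
    simpa using this
  rw [← hperm.countP_eq] at h
  have hlen : k - 1 < S.length := by
    have := h.trans List.countP_le_length
    omega
  rw [List.getD_eq_getElem _ _ hlen]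
  by_contra! hlt
  have hdrop : (S.drop (k - 1)).countP (fun x => decide (c ≤ x)) = 0 := by
    rw [List.countP_eq_zero]
    intro x hx
    obtain ⟨i, hi, rfl⟩ := List.mem_iff_getElem.mp hx
    rw [List.getElem_drop]
    have hle : S[k - 1 + i]'(by rw [List.length_drop] at hi; omega) ≤ S[k - 1] := by
      rcases Nat.eq_zero_or_pos i with rfl | hi'
      · simp
      · exact List.pairwise_iff_getElem.mp hsorted _ _ _ _ (by omega)
    simpa using hle.trans_lt hlt
  have htake : (S.take (k - 1)).countP (fun x => decide (c ≤ x)) ≤ k - 1 :=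
    List.countP_le_length.trans (by simp)
  rw [← List.take_append_drop (k - 1) S, List.countP_append, hdrop] at h
  omega

theorem le_kthLargestEig_of_le_card {n : ℕ} {A : Matrix (Fin n) (Fin n) ℝ} (hA : A.IsHermitian)
    {c : ℝ} {k : ℕ} (hk : 0 < k)
    (h : k ≤ (Finset.univ.filter fun i => c ≤ hA.eigenvalues i).card) :
    c ≤ kthLargestEig A k := by
  rw [kthLargestEig, dif_pos hA]
  refine List.le_getD_mergeSort_of_le_countP _ hk (h.trans_eq ?_)
  rw [List.ofFn_eq_map, List.countP_map, List.countP_eq_length_filter]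
  rfl

theorem Matrix.IsHermitian.dotProduct_eq_sum_eigenvectorBasis {n : Type*} [Fintype n]
    [DecidableEq n] {A : Matrix n n ℝ} (hA : A.IsHermitian) (x y : n → ℝ) :
    x ⬝ᵥ y = ∑ i, (hA.eigenvectorBasis i ⬝ᵥ x) * (hA.eigenvectorBasis i ⬝ᵥ y) := by
  have := hA.eigenvectorBasis.sum_inner_mul_inner (WithLp.toLp 2 x) (WithLp.toLp 2 y)
  simp only [EuclideanSpace.inner_eq_star_dotProduct, star_trivial] at this
  rw [dotProduct_comm x y, ← this]
  refine Finset.sum_congr rfl fun i _ => ?_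
  rw [dotProduct_comm y]

theorem Matrix.IsHermitian.dotProduct_mulVec_eq_sum_eigenvalues {n : Type*} [Fintype n]
    [DecidableEq n] {A : Matrix n n ℝ} (hA : A.IsHermitian) (x : n → ℝ) :
    x ⬝ᵥ A *ᵥ x = ∑ i, hA.eigenvalues i * (hA.eigenvectorBasis i ⬝ᵥ x) ^ 2 := by
  rw [hA.dotProduct_eq_sum_eigenvectorBasis]
  refine Finset.sum_congr rfl fun i _ => ?_
  have hT : Aᵀ = A := by simpa [Matrix.IsHermitian, conjTranspose_eq_transpose_of_trivial] using hA
  rw [dotProduct_mulVec, ← mulVec_transpose, hT, hA.mulVec_eigenvectorBasis, smul_dotProduct,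
    smul_eq_mul]
  ring

/-- The lower bound in the Courant–Fischer principle. -/
theorem Matrix.IsHermitian.finrank_le_card_eigenvalues_ge {n V : Type*} [Fintype n]
    [DecidableEq n] [AddCommGroup V] [Module ℝ V] [FiniteDimensional ℝ V] {A : Matrix n n ℝ}
    (hA : A.IsHermitian) {c : ℝ} (f : V →ₗ[ℝ] n → ℝ) (hf : Function.Injective f)
    (h : ∀ v, c * (f v ⬝ᵥ f v) ≤ f v ⬝ᵥ A *ᵥ f v) :
    Module.finrank ℝ V ≤ (Finset.univ.filter fun i => c ≤ hA.eigenvalues i).card := by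
  by_contra! hlt
  let U : Matrix {i // c ≤ hA.eigenvalues i} n ℝ := Matrix.of fun i => ⇑(hA.eigenvectorBasis i)
  obtain ⟨v, hv, hv0⟩ := (Submodule.ne_bot_iff _).mp
    (LinearMap.ker_ne_bot_of_finrank_lt (f := U.mulVecLin ∘ₗ f)
      (by rwa [Module.finrank_fintype_fun_eq_card, Fintype.card_subtype]))
  have hU : ∀ i, c ≤ hA.eigenvalues i → hA.eigenvectorBasis i ⬝ᵥ f v = 0 := fun i hi =>
    congrFun (LinearMap.mem_ker.mp hv) ⟨i, hi⟩
  have hx : f v ⬝ᵥ f v ≠ 0 := by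
    rwa [Ne, dotProduct_self_eq_zero, map_eq_zero_iff f hf]
  have hle := h v
  rw [hA.dotProduct_mulVec_eq_sum_eigenvalues] at hle
  rw [hA.dotProduct_eq_sum_eigenvectorBasis] at hle hx
  obtain ⟨j, -, hj⟩ := Finset.exists_ne_zero_of_sum_ne_zero hx
  refine hle.not_gt ?_
  rw [Finset.mul_sum]
  refine Finset.sum_lt_sum (fun i _ => ?_) ⟨j, Finset.mem_univ j, ?_⟩
  · by_cases hi : c ≤ hA.eigenvalues i
    · simp [hU i hi]
    · rw [← sq]
      exact mul_le_mul_of_nonneg_right (not_le.mp hi).le (sq_nonneg _)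
  · have hj0 := left_ne_zero_of_mul hj
    have hjc : hA.eigenvalues j < c := by
      by_contra! hc
      exact hj0 (hU j hc)
    rw [← sq]
    exact mul_lt_mul_of_pos_right hjc (by positivity)

theorem thetaB_isHermitian (p q : ℝ) (l n : ℕ) : (thetaB p q l n).IsHermitian := by
  ext i j
  simp [thetaB, eq_comm]

theorem sum_commB (l s : ℕ) (g : ℕ → ℝ) :
    ∑ i : Fin (2 * l + s), g (commB l i) = l * g 0 + l * g 1 + s * g 2 := by
  have h : ∀ i : Fin (2 * l + s),
      g (commB l i) = g (if (i : ℕ) < l then 0 else if (i : ℕ) < 2 * l then 1 else 2) :=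
    fun i => rfl
  simp only [h]
  rw [Fin.sum_univ_eq_sum_range
      (fun i => g (if i < l then 0 else if i < 2 * l then 1 else 2)) (2 * l + s), two_mul,
    Finset.sum_range_add, Finset.sum_range_add]
  congr 1
  · congr 1
    · rw [Finset.sum_congr rfl (g := fun _ => g 0)]
      · simp
      · intro i hi
        rw [if_pos (Finset.mem_range.mp hi)]
    · rw [Finset.sum_congr rfl (g := fun _ => g 1)]
      · simp
      · intro i hi
        have := Finset.mem_range.mp hi
        rw [if_neg (by omega), if_pos (by omega)]
  · rw [Finset.sum_congr rfl (g := fun _ => g 2)]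
    · simp
    · intro i _
      rw [if_neg (by omega), if_neg (by omega)]

theorem thetaB_dotProduct_mulVec (p q : ℝ) (l s : ℕ) (a : ℕ → ℝ) :
    (fun i => a (commB l i)) ⬝ᵥ thetaB p q l (2 * l + s) *ᵥ (fun i => a (commB l i)) =
      (p - q) * ((l * a 0) ^ 2 + (l * a 1) ^ 2 + (s * a 2) ^ 2) +
        q * (l * a 0 + l * a 1 + s * a 2) ^ 2 := by
  simp only [dotProduct, mulVec, thetaB, Matrix.of_apply]
  rw [Finset.sum_congr rfl fun i _ => congrArg (a (commB l i) * ·)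
      (sum_commB l s fun k => (if commB l i = k then p else q) * a k),
    sum_commB l s fun m => a m * (l * ((if m = 0 then p else q) * a 0) +
      l * ((if m = 1 then p else q) * a 1) + s * ((if m = 2 then p else q) * a 2))]
  norm_num
  ring

/-- Lemma 1, second part: the third largest eigenvalue of the expected
weight matrix `M = E[W_B]` of the three-community SBM satisfies `λ₃(M) ≥ (p - q) s`. -/
theorem expected_WB_third_eigenvalue_lower_bound (p q : ℝ) (l s : ℕ)
    (hq : 0 < q) (hpq : q < p) (hp : p ≤ 1) (hs : 0 < s) (hsl : s < l) :
    (p - q) * s ≤ kthLargestEig (thetaB p q l (2 * l + s)) 3 := by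
  have hA := thetaB_isHermitian p q l (2 * l + s)
  have hsurj : Function.Surjective fun i : Fin (2 * l + s) => Fin.ofNat 3 (commB l i) := by
    intro k
    fin_cases k
    · exact ⟨⟨0, by omega⟩, by simp [commB, hs.trans hsl]⟩
    · exact ⟨⟨l, by omega⟩, by simp [commB, hs.trans hsl]; rfl⟩
    · exact ⟨⟨2 * l, by omega⟩, by simp [commB, show ¬ 2 * l < l by omega]⟩
  refine le_kthLargestEig_of_le_card hA (by norm_num) ?_
  have hcard := hA.finrank_le_card_eigenvalues_ge (c := (p - q) * s)
    (LinearMap.funLeft ℝ ℝ fun i : Fin (2 * l + s) => Fin.ofNat 3 (commB l i))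
    (LinearMap.funLeft_injective_of_surjective ℝ ℝ _ hsurj) fun v => ?_
  · simpa using hcard
  · have hsl' : (s : ℝ) ≤ l := by exact_mod_cast hsl.le
    have hweight : ∀ x : ℝ, s * (l * x ^ 2) ≤ (l * x) ^ 2 := fun x => by
      have := mul_le_mul_of_nonneg_right hsl' (by positivity : (0 : ℝ) ≤ l * x ^ 2)
      linarith
    let a : ℕ → ℝ := fun k => v (Fin.ofNat 3 k)
    have hnorm := sum_commB l s fun k => a k * a k
    change (p - q) * s * ∑ i : Fin (2 * l + s), a (commB l i) * a (commB l i) ≤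
      (fun i => a (commB l i)) ⬝ᵥ thetaB p q l (2 * l + s) *ᵥ (fun i => a (commB l i))
    rw [thetaB_dotProduct_mulVec, hnorm]
    have hmain : s * (l * (a 0 * a 0) + l * (a 1 * a 1) + s * (a 2 * a 2)) ≤
        (l * a 0) ^ 2 + (l * a 1) ^ 2 + (s * a 2) ^ 2 := by
      linarith [hweight (a 0), hweight (a 1)]
    have hscaled := mul_le_mul_of_nonneg_left hmain (sub_nonneg.mpr hpq.le)
    have hsq := mul_nonneg hq.le (sq_nonneg (l * a 0 + l * a 1 + s * a 2))
    linarith
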